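/- arXiv:1302.4692 — 2 statements merged into one kernel-verified Lean document; each statement's English description precedes it below -/
import Mathlib

section
/- Define cl(x) := arsinh(1/sinh(x/2)) for x > 0. Then for all real x with 0 < x < 1/4: (i) 2·(cl(x) − 1.3) > 5·x·cosh(cl(x) − 1.3); (ii) x·cosh(cl(x) − 1.3) > 1/2; and consequently (iii) 2·(cl(x) − 1.3) > x and cl(x) > (3/2)·1.3. -/
open Real

/-- The collar width function `cl(x) := arsinh (1 / sinh (x/2))` of the collar
theorem for hyperbolic surfaces. For a simple closed geodesic of length `x`,
`x·cosh(cl(x) - 1.3)` is the length of each boundary component of the collar of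
width `cl(x) - 1.3`, and `2·(cl(x) - 1.3)` is the distance between the two
boundary components. -/
noncomputable def cl (x : ℝ) : ℝ := Real.arsinh (1 / Real.sinh (x / 2))

theorem sinh_le_self_mul_cosh {y : ℝ} (hy : 0 ≤ y) : Real.sinh y ≤ y * Real.cosh y := by
  have hmono : MonotoneOn (fun t : ℝ => t * Real.cosh t - Real.sinh t) (Set.Ici 0) := by
    refine monotoneOn_of_hasDerivWithinAt_nonneg (f' := fun t => t * Real.sinh t)
      (convex_Ici 0) (by fun_prop) (fun t _ => ?_) (fun t ht => ?_)
    · have h := ((hasDerivAt_id t).mul (Real.hasDerivAt_cosh t)).sub (Real.hasDerivAt_sinh t)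
      refine (h.congr_deriv ?_).hasDerivWithinAt
      simp
    · rw [interior_Ici] at ht
      exact mul_nonneg (le_of_lt ht) (Real.sinh_nonneg_iff.2 (le_of_lt ht))
  have h := hmono Set.self_mem_Ici (Set.mem_Ici.2 hy) hy
  simp at h
  exact h

/-- The closed form `exp (cl x) = coth (x / 4)`. -/
theorem cl_four_mul {y : ℝ} (hy : 0 < y) :
    cl (4 * y) = Real.log (Real.cosh y / Real.sinh y) := by
  have hs : 0 < Real.sinh y := Real.sinh_pos_iff.2 hy
  have hc : 0 < Real.cosh y := Real.cosh_pos y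
  rw [cl, ← Real.arsinh_sinh (Real.log _), Real.sinh_log (div_pos hc hs),
    show 4 * y / 2 = 2 * y by ring, Real.sinh_two_mul]
  congr 1
  field_simp
  linarith [Real.cosh_sq y]

theorem exp_thirteen_tenths_bounds : 3.66 < Real.exp 1.3 ∧ Real.exp 1.3 < 3.68 := by
  have h : Real.exp 1.3 ^ 10 = Real.exp 1 ^ 13 := by
    rw [← Real.exp_nat_mul, ← Real.exp_nat_mul]
    norm_num
  constructor
  · refine lt_of_pow_lt_pow_left₀ 10 (Real.exp_pos _).le ?_
    rw [h]
    exact lt_trans (by norm_num) (pow_lt_pow_left₀ Real.exp_one_gt_d9 (by norm_num) (by norm_num))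
  · refine lt_of_pow_lt_pow_left₀ 10 (by norm_num) ?_
    rw [h]
    exact lt_trans (pow_lt_pow_left₀ Real.exp_one_lt_d9 (Real.exp_pos _).le (by norm_num))
      (by norm_num)

theorem cosh_le_of_le_one_sixteenth {y : ℝ} (hy : 0 ≤ y) (hy' : y ≤ 1 / 16) :
    Real.cosh y ≤ 1.002 := by
  refine (Real.cosh_le_exp_half_sq y).trans ?_
  have h1 : y ^ 2 / 2 ≤ 1 / 512 := by nlinarith
  have h2 : 1 - y ^ 2 / 2 ≤ Real.exp (-(y ^ 2 / 2)) := Real.one_sub_le_exp_neg _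
  have h3 : Real.exp (-(y ^ 2 / 2)) * Real.exp (y ^ 2 / 2) = 1 := by
    rw [← Real.exp_add]; simp
  nlinarith [Real.exp_pos (y ^ 2 / 2)]

/-- For all real `x` with `0 < x < 1/4`:
(i) `2·(cl(x) - 1.3) > 5·x·cosh(cl(x) - 1.3)`;
(ii) `x·cosh(cl(x) - 1.3) > 1/2`; and consequently
(iii) `2·(cl(x) - 1.3) > x` and `cl(x) > (3/2)·1.3`. -/
theorem stmt_18 (x : ℝ) (hx0 : 0 < x) (hx : x < 1 / 4) :
    2 * (cl x - 1.3) > 5 * (x * Real.cosh (cl x - 1.3)) ∧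
    x * Real.cosh (cl x - 1.3) > 1 / 2 ∧
    2 * (cl x - 1.3) > x ∧ cl x > 3 / 2 * 1.3 := by
  obtain ⟨y, rfl⟩ : ∃ y, x = 4 * y := ⟨x / 4, by ring⟩
  have hy0 : 0 < y := by linarith
  have hy : y < 1 / 16 := by linarith
  have hs : 0 < Real.sinh y := Real.sinh_pos_iff.2 hy0
  have hc : 0 < Real.cosh y := Real.cosh_pos y
  have hys : y ≤ Real.sinh y := Real.self_le_sinh_iff.2 hy0.le
  have hsy := sinh_le_self_mul_cosh hy0.le
  have hc2 := cosh_le_of_le_one_sixteenth hy0.le hy.le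
  obtain ⟨he1, he2⟩ := exp_thirteen_tenths_bounds
  have hE : 0 < Real.exp 1.3 := Real.exp_pos _
  set q := Real.cosh y / Real.sinh y with hq
  have hq0 : 0 < q := div_pos hc hs
  have hcl : cl (4 * y) = Real.log q := cl_four_mul hy0
  have hq1 : 1 ≤ y * q := by
    rw [hq, mul_div_assoc', one_le_div hs]; exact hsy
  have hq2 : y * q ≤ 1.002 := by
    rw [hq, mul_div_assoc', div_le_iff₀ hs]
    nlinarith
  have hqi : q⁻¹ ≤ y := by
    rw [inv_le_iff_one_le_mul₀ hq0]; exact hq1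
  have hq16 : 16 < q := by nlinarith
  have hlog : 2.772 < cl (4 * y) := by
    have h16 : Real.log 16 = 4 * Real.log 2 := by
      rw [show (16 : ℝ) = 2 ^ 4 by norm_num, Real.log_pow]; norm_num
    have h := Real.log_lt_log (by norm_num) hq16
    rw [hcl]
    linarith [Real.log_two_gt_d9]
  have hcosh : 4 * y * Real.cosh (cl (4 * y) - 1.3) =
      2 * (y * q) * (Real.exp 1.3)⁻¹ + 2 * (y * q⁻¹) * Real.exp 1.3 := by
    rw [hcl, Real.cosh_eq, neg_sub, Real.exp_sub, Real.exp_sub, Real.exp_log hq0]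
    field_simp
    ring
  have hi0 : 0 < q⁻¹ := inv_pos.2 hq0
  have hEi1 : 1 / 4 < (Real.exp 1.3)⁻¹ := by
    rw [lt_inv_comm₀ (by norm_num) hE]; linarith
  have hEi2 : (Real.exp 1.3)⁻¹ < 0.2733 := by
    rw [inv_lt_comm₀ hE (by norm_num)]
    exact lt_trans (by norm_num) he1
  have hyq : y * q⁻¹ ≤ 1 / 256 := by nlinarith
  have hyq0 : 0 < y * q⁻¹ := mul_pos hy0 hi0
  rw [hcosh]
  refine ⟨?_, ?_, by linarith, by linarith⟩
  · have h1 : y * q * (Real.exp 1.3)⁻¹ ≤ 1.002 * 0.2733 :=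
      mul_le_mul hq2 hEi2.le (inv_pos.2 hE).le (by norm_num)
    have h2 : y * q⁻¹ * Real.exp 1.3 ≤ 1 / 256 * 3.68 :=
      mul_le_mul hyq he2.le hE.le (by norm_num)
    linarith
  · have h1 : 1 * (1 / 4) < y * q * (Real.exp 1.3)⁻¹ :=
      mul_lt_mul' hq1 hEi1 (by norm_num) (by linarith)
    have h2 := mul_pos hyq0 hE
    linarith
end

section
/- Define cl(x) := arsinh(1/sinh(x/2)) for x > 0. Then: (i) cl is strictly decreasing on (0, 2·arsinh(1)]; (ii) x ≤ 2·cl(x) for all x ∈ (0, 2·arsinh(1)]; (iii) the function x ↦ 1/(x·cl(x)) is strictly decreasing on (0, 2·arsinh(1)]; and (iv) cl(x) is asymptotically equivalent to −log x as x → 0⁺, i.e. lim_{x→0⁺} arsinh(1/sinh(x/2))/(−log x) = 1. -/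
open Real

theorem cl_pos {x : ℝ} (hx : 0 < x) : 0 < cl x :=
  arsinh_pos_iff.2 (one_div_pos.2 (sinh_pos_iff.2 (half_pos hx)))

theorem sqrt_one_add_one_div_sinh_sq {t : ℝ} (ht : 0 < t) :
    √(1 + (1 / sinh t) ^ 2) = cosh t / sinh t := by
  have hs : 0 < sinh t := sinh_pos_iff.2 ht
  rw [Real.sqrt_eq_iff_mul_self_eq (by positivity) (by have := cosh_pos t; positivity)]
  field_simp
  linarith [cosh_sq t]

theorem cl_strictAntiOn : StrictAntiOn cl (Set.Ioi 0) := by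
  intro x hx y _ hxy
  have hx0 : 0 < x := hx
  refine arsinh_lt_arsinh.2 (one_div_lt_one_div_of_lt (sinh_pos_iff.2 (half_pos hx0)) ?_)
  exact sinh_lt_sinh.2 (by linarith)

theorem le_two_mul_cl {x : ℝ} (hx : 0 < x) (hx' : x ≤ 2 * arsinh 1) : x ≤ 2 * cl x := by
  have hs : 0 < sinh (x / 2) := sinh_pos_iff.2 (half_pos hx)
  have h1 : sinh (x / 2) ≤ 1 := by
    rw [← sinh_arsinh 1]
    exact sinh_le_sinh.2 (by linarith)
  have h : x / 2 ≤ cl x := by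
    rw [← sinh_le_sinh, cl, sinh_arsinh]
    exact h1.trans (one_le_one_div hs h1)
  linarith

theorem hasDerivAt_sinh_half (x : ℝ) :
    HasDerivAt (fun y : ℝ => sinh (y / 2)) (cosh (x / 2) * (1 / 2)) x :=
  ((hasDerivAt_id x).div_const 2).sinh

theorem hasDerivAt_cl {x : ℝ} (hx : 0 < x) :
    HasDerivAt cl (-(1 / (2 * sinh (x / 2)))) x := by
  have hs : 0 < sinh (x / 2) := sinh_pos_iff.2 (half_pos hx)
  have hc := cosh_pos (x / 2)
  have h := (((hasDerivAt_const x (1 : ℝ)).fun_div (hasDerivAt_sinh_half x) hs.ne')).arsinh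
  rw [sqrt_one_add_one_div_sinh_sq (half_pos hx)] at h
  refine h.congr_deriv ?_
  simp only [smul_eq_mul]
  field_simp
  ring

theorem hasDerivAt_mul_cl {x : ℝ} (hx : 0 < x) :
    HasDerivAt (fun y => y * cl y) (cl x - x / 2 / sinh (x / 2)) x := by
  have hs : 0 < sinh (x / 2) := sinh_pos_iff.2 (half_pos hx)
  refine ((hasDerivAt_id x).fun_mul (hasDerivAt_cl hx)).congr_deriv ?_
  simp only [id]
  field_simp
  ring

theorem hasDerivAt_cl_sub {x : ℝ} (hx : 0 < x) :
    HasDerivAt (fun y => cl y - y / 2 / sinh (y / 2))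
      ((x / 2 * cosh (x / 2) - 2 * sinh (x / 2)) / (2 * sinh (x / 2) ^ 2)) x := by
  have hs : 0 < sinh (x / 2) := sinh_pos_iff.2 (half_pos hx)
  refine ((hasDerivAt_cl hx).fun_sub
    (((hasDerivAt_id x).div_const 2).fun_div (hasDerivAt_sinh_half x) hs.ne')).congr_deriv ?_
  simp only [id]
  field_simp
  ring

theorem cosh_lt_two {t : ℝ} (ht : 0 < t) (ht' : t < arsinh 1) : cosh t < 2 := by
  have h1 : sinh t < 1 := by
    rw [← sinh_arsinh 1]
    exact sinh_lt_sinh.2 ht'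
  have h0 : 0 < sinh t := sinh_pos_iff.2 ht
  nlinarith [cosh_sq t, cosh_pos t]

theorem half_div_sinh_lt_cl {x : ℝ} (hx : 0 < x) (hx' : x < 2 * arsinh 1) :
    x / 2 / sinh (x / 2) < cl x := by
  have ha : 0 < 2 * arsinh 1 := hx.trans hx'
  have hanti : StrictAntiOn (fun y => cl y - y / 2 / sinh (y / 2))
      (Set.Ioc 0 (2 * arsinh 1)) := by
    refine strictAntiOn_of_deriv_neg (convex_Ioc _ _)
      (fun y hy => (hasDerivAt_cl_sub hy.1).continuousAt.continuousWithinAt) fun y hy => ?_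
    rw [interior_Ioc] at hy
    rw [(hasDerivAt_cl_sub hy.1).deriv]
    have ht : 0 < y / 2 := half_pos hy.1
    have hs : 0 < sinh (y / 2) := sinh_pos_iff.2 ht
    refine div_neg_of_neg_of_pos ?_ (by positivity)
    have h2 := cosh_lt_two ht (by linarith [hy.2])
    have h3 : y / 2 < sinh (y / 2) := self_lt_sinh_iff.2 ht
    nlinarith
  have h := hanti ⟨hx, hx'.le⟩ ⟨ha, le_rfl⟩ hx'
  have he : cl (2 * arsinh 1) - 2 * arsinh 1 / 2 / sinh (2 * arsinh 1 / 2) = 0 := by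
    simp [cl]
  simp only [he] at h
  linarith

theorem strictMonoOn_mul_cl :
    StrictMonoOn (fun x => x * cl x) (Set.Ioc 0 (2 * arsinh 1)) := by
  refine strictMonoOn_of_deriv_pos (convex_Ioc _ _)
    (fun y hy => (hasDerivAt_mul_cl hy.1).continuousAt.continuousWithinAt) fun y hy => ?_
  rw [interior_Ioc] at hy
  rw [(hasDerivAt_mul_cl hy.1).deriv]
  exact sub_pos.2 (half_div_sinh_lt_cl hy.1 hy.2)

theorem cl_add_log {x : ℝ} (hx : 0 < x) :
    cl x + log x = log ((1 + cosh (x / 2)) / (sinh (x / 2) / x)) := by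
  have hs : 0 < sinh (x / 2) := sinh_pos_iff.2 (half_pos hx)
  have hc := cosh_pos (x / 2)
  rw [cl, arsinh, sqrt_one_add_one_div_sinh_sq (half_pos hx),
    ← log_mul (by positivity) hx.ne']
  congr 1
  field_simp

theorem tendsto_cl_add_log :
    Filter.Tendsto (fun x => cl x + log x) (nhdsWithin 0 (Set.Ioi 0)) (nhds (log 4)) := by
  have hslope : Filter.Tendsto (fun x : ℝ => sinh (x / 2) / x)
      (nhdsWithin 0 (Set.Ioi 0)) (nhds (1 / 2)) := by
    have h := (hasDerivAt_sinh_half 0).tendsto_slope_zero_right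
    simp only [zero_add, zero_div, sinh_zero, sub_zero, cosh_zero, one_mul, smul_eq_mul] at h
    exact h.congr fun x => (div_eq_inv_mul _ _).symm
  have hcosh : Filter.Tendsto (fun x : ℝ => 1 + cosh (x / 2))
      (nhdsWithin 0 (Set.Ioi 0)) (nhds 2) := by
    have h : Continuous fun x : ℝ => 1 + cosh (x / 2) := by fun_prop
    have h0 := h.tendsto 0
    norm_num at h0
    exact h0.mono_left nhdsWithin_le_nhds
  have h := (hcosh.div hslope (by norm_num)).log (by norm_num)
  norm_num at h
  refine h.congr' ?_
  filter_upwards [self_mem_nhdsWithin] with x hx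
  exact (cl_add_log hx).symm

theorem tendsto_cl_div_neg_log :
    Filter.Tendsto (fun x : ℝ => cl x / (-log x)) (nhdsWithin 0 (Set.Ioi 0)) (nhds 1) := by
  have hlog : Filter.Tendsto (fun x => -log x) (nhdsWithin 0 (Set.Ioi 0)) Filter.atTop :=
    Filter.tendsto_neg_atBot_atTop.comp tendsto_log_nhdsGT_zero
  have h := (tendsto_cl_add_log.div_atTop hlog).add_const 1
  rw [zero_add] at h
  refine h.congr' ?_
  filter_upwards [hlog.eventually_gt_atTop 0] with x hx
  have hne : log x ≠ 0 := (neg_pos.1 hx).ne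
  field_simp
  ring

/-- (i) `cl` is strictly decreasing on `(0, 2·arsinh 1]`;
(ii) `x ≤ 2·cl(x)` for all `x ∈ (0, 2·arsinh 1]`;
(iii) `x ↦ 1/(x·cl(x))` is strictly decreasing on `(0, 2·arsinh 1]`;
(iv) `cl(x)` is asymptotically equivalent to `-log x` as `x → 0⁺`, i.e.
`lim_{x→0⁺} cl(x)/(-log x) = 1`. -/
theorem stmt_19 :
    StrictAntiOn cl (Set.Ioc 0 (2 * Real.arsinh 1)) ∧
    (∀ x ∈ Set.Ioc (0 : ℝ) (2 * Real.arsinh 1), x ≤ 2 * cl x) ∧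
    StrictAntiOn (fun x : ℝ => 1 / (x * cl x)) (Set.Ioc 0 (2 * Real.arsinh 1)) ∧
    Filter.Tendsto (fun x : ℝ => cl x / (-Real.log x))
      (nhdsWithin 0 (Set.Ioi 0)) (nhds 1) := by
  refine ⟨cl_strictAntiOn.mono fun x hx => hx.1, fun x hx => le_two_mul_cl hx.1 hx.2, ?_,
    tendsto_cl_div_neg_log⟩
  intro x hx y hy hxy
  exact one_div_lt_one_div_of_lt (mul_pos hx.1 (cl_pos hx.1)) (strictMonoOn_mul_cl hx hy hxy)
end
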